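/- (Monotonicity in the scale / noise level.) For every nonempty bounded set A ⊆ ℝⁿ, the function t ↦ R*(tA) is non-decreasing on (0, ∞), and the function t ↦ R*(tA)/t is non-increasing on (0, ∞), where tA = { tθ : θ ∈ A }. -/

import Mathlib

open MeasureTheory ENNReal Real Set
open scoped Pointwise

noncomputable section

/-- The Shtarkov integral `(2π)^{-n/2} ∫ exp(-dist(x,A)²/2) dx`. -/
def shtarkov (n : ℕ) (A : Set (EuclideanSpace ℝ (Fin n))) : ℝ≥0∞ :=
  ∫⁻ x, ENNReal.ofReal ((2 * π) ^ (-(n : ℝ) / 2) * Real.exp (-(Metric.infDist x A) ^ 2 / 2))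

/-- The minimax regret `R*(A) = log((2π)^{-n/2} ∫ exp(-dist(x,A)²/2) dx)`, as a real
number (finite for nonempty bounded `A`). -/
def regretReal (n : ℕ) (A : Set (EuclideanSpace ℝ (Fin n))) : ℝ :=
  Real.log (shtarkov n A).toReal

open Filter Topology

theorem volume_add_le_volume_add_of_isCompact {K L : Set ℝ} (hK : IsCompact K) (hL : IsCompact L)
    (hK₀ : K.Nonempty) (hL₀ : L.Nonempty) : volume K + volume L ≤ volume (K + L) := by
  obtain ⟨p, hp, hpK⟩ := hK.exists_isGreatest hK₀
  obtain ⟨q, hq, hqL⟩ := hL.exists_isLeast hL₀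
  have hsub : (K + {q}) ∪ ({p} + L) ⊆ K + L :=
    union_subset (add_subset_add_left (singleton_subset_iff.2 hq))
      (add_subset_add_right (singleton_subset_iff.2 hp))
  have hinter : volume ((K + {q}) ∩ ({p} + L)) = 0 := by
    refine measure_mono_null (t := {p + q}) ?_ (by simp)
    rintro z ⟨hz₁, hz₂⟩
    obtain ⟨x, hx, _, rfl, rfl⟩ := hz₁
    obtain ⟨_, rfl, y, hy, hxy⟩ := hz₂
    have h₁ := hpK hx
    have h₂ := hqL hy
    simp only [mem_singleton_iff] at *
    linarith
  have hmeas : MeasurableSet ({p} + L) := (isCompact_singleton.add hL).measurableSet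
  have h := measure_union_add_inter (μ := volume) (K + {q}) hmeas
  rw [hinter, add_zero] at h
  have h₁ : volume (K + {q}) = volume K := by
    rw [add_singleton]; simp
  have h₂ : volume ({p} + L) = volume L := by
    rw [singleton_add]; simp
  rw [← h₁, ← h₂, ← h]
  exact measure_mono hsub

/-- The one-dimensional Brunn-Minkowski inequality. -/
theorem volume_add_le_volume_add {S T : Set ℝ} (hS : MeasurableSet S) (hT : MeasurableSet T)
    (hS₀ : S.Nonempty) (hT₀ : T.Nonempty) : volume S + volume T ≤ volume (S + T) := by
  obtain ⟨p, hp⟩ := hS₀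
  obtain ⟨q, hq⟩ := hT₀
  rw [hS.measure_eq_iSup_isCompact, hT.measure_eq_iSup_isCompact]
  simp_rw [iSup_and']
  refine ENNReal.biSup_add_biSup_le' ⟨∅, empty_subset _, isCompact_empty⟩
    ⟨∅, empty_subset _, isCompact_empty⟩ ?_
  rintro K ⟨hKS, hK⟩ L ⟨hLT, hL⟩
  calc volume K + volume L ≤ volume (insert p K) + volume (insert q L) :=
        add_le_add (measure_mono (subset_insert _ _)) (measure_mono (subset_insert _ _))
    _ ≤ volume (insert p K + insert q L) :=
        volume_add_le_volume_add_of_isCompact (hK.insert p) (hL.insert q)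
          (insert_nonempty _ _) (insert_nonempty _ _)
    _ ≤ volume (S + T) :=
        measure_mono (add_subset_add (insert_subset hp hKS) (insert_subset hq hLT))

theorem ENNReal.rpow_mul_rpow_le_add {a b : ℝ} (ha : 0 < a) (hb : 0 < b) (hab : a + b = 1)
    (x y : ℝ≥0∞) : x ^ a * y ^ b ≤ ENNReal.ofReal a * x + ENNReal.ofReal b * y := by
  rcases eq_or_ne x ∞ with rfl | hx
  · simp [ENNReal.mul_top, ha]
  rcases eq_or_ne y ∞ with rfl | hy
  · simp [ENNReal.mul_top, hb]
  lift x to NNReal using hx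
  lift y to NNReal using hy
  rw [← ENNReal.coe_rpow_of_nonneg _ ha.le, ← ENNReal.coe_rpow_of_nonneg _ hb.le]
  have h := NNReal.geom_mean_le_arith_mean2_weighted a.toNNReal b.toNNReal x y
    (by rw [← Real.toNNReal_add ha.le hb.le, hab, Real.toNNReal_one])
  rw [Real.coe_toNNReal _ ha.le, Real.coe_toNNReal _ hb.le] at h
  simp only [ENNReal.ofReal]
  exact_mod_cast h

theorem lintegral_eq_setLIntegral_meas_lt_of_le_one {α : Type*} [MeasurableSpace α]
    (μ : Measure α) {f : α → ℝ≥0∞} (hf : Measurable f) (hf₁ : ∀ x, f x ≤ 1) :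
    ∫⁻ x, f x ∂μ = ∫⁻ t in Ioo (0 : ℝ) 1, μ {x | ENNReal.ofReal t < f x} := by
  have hfin : ∀ x, f x ≠ ∞ := fun x => ((hf₁ x).trans_lt one_lt_top).ne
  have h₁ : ∫⁻ x, f x ∂μ = ∫⁻ x, ENNReal.ofReal (f x).toReal ∂μ :=
    lintegral_congr fun x => (ENNReal.ofReal_toReal (hfin x)).symm
  rw [h₁, lintegral_eq_lintegral_meas_lt μ (ae_of_all _ fun _ => toReal_nonneg)
    hf.ennreal_toReal.aemeasurable, ← lintegral_indicator measurableSet_Ioi,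
    ← lintegral_indicator measurableSet_Ioo]
  refine lintegral_congr fun t => ?_
  by_cases ht : 0 < t
  · by_cases ht₁ : t < 1
    · rw [indicator_of_mem (show t ∈ Ioi 0 from ht),
        indicator_of_mem (show t ∈ Ioo 0 1 from ⟨ht, ht₁⟩)]
      simp_rw [ENNReal.ofReal_lt_iff_lt_toReal ht.le (hfin _)]
    · rw [indicator_of_mem (show t ∈ Ioi 0 from ht), indicator_of_notMem (fun h => ht₁ h.2)]
      have : {x | t < (f x).toReal} = ∅ := by
        refine eq_empty_of_forall_notMem fun x hx => ht₁ (lt_of_lt_of_le hx ?_)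
        exact ENNReal.toReal_le_of_le_ofReal zero_le_one (by simpa using hf₁ x)
      rw [this, measure_empty]
  · rw [indicator_of_notMem (show t ∉ Ioi 0 from ht), indicator_of_notMem (fun h => ht h.1)]

theorem prekopa_leindler_real_of_le_one {a b : ℝ} (ha : 0 < a) (hb : 0 < b) (hab : a + b = 1)
    {f g h : ℝ → ℝ≥0∞} (hf : Measurable f) (hg : Measurable g) (hh : Measurable h)
    (hf₁ : ∀ x, f x ≤ 1) (hg₁ : ∀ x, g x ≤ 1) (hfs : ∀ u < 1, ∃ x, u < f x)
    (hgs : ∀ u < 1, ∃ x, u < g x) (hfgh : ∀ x y, f x ^ a * g y ^ b ≤ h (a * x + b * y)) :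
    (∫⁻ x, f x) ^ a * (∫⁻ x, g x) ^ b ≤ ∫⁻ x, h x := by
  refine (ENNReal.rpow_mul_rpow_le_add ha hb hab _ _).trans ?_
  refine le_trans ?_ (lintegral_mono fun x => min_le_left (h x) 1)
  rw [lintegral_eq_setLIntegral_meas_lt_of_le_one _ hf hf₁,
    lintegral_eq_setLIntegral_meas_lt_of_le_one _ hg hg₁,
    lintegral_eq_setLIntegral_meas_lt_of_le_one _ (hh.min measurable_const)
      fun x => min_le_right _ _, ← lintegral_const_mul' _ _ ofReal_ne_top,
    ← lintegral_const_mul' _ _ ofReal_ne_top, ← lintegral_add_left']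
  · refine setLIntegral_mono' measurableSet_Ioo fun t ht => ?_
    have ht₁ : ENNReal.ofReal t < 1 := by simpa using ht.2
    have hS : MeasurableSet {x | ENNReal.ofReal t < f x} := measurableSet_lt measurable_const hf
    have hT : MeasurableSet {x | ENNReal.ofReal t < g x} := measurableSet_lt measurable_const hg
    have hsub : a • {x | ENNReal.ofReal t < f x} + b • {x | ENNReal.ofReal t < g x} ⊆
        {x | ENNReal.ofReal t < min (h x) 1} := by
      rintro _ ⟨_, ⟨x, hx, rfl⟩, _, ⟨y, hy, rfl⟩, rfl⟩
      refine lt_min ?_ ht₁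
      calc ENNReal.ofReal t = ENNReal.ofReal t ^ a * ENNReal.ofReal t ^ b := by
            rw [← ENNReal.rpow_add_of_nonneg _ _ ha.le hb.le, hab, ENNReal.rpow_one]
        _ < f x ^ a * g y ^ b :=
            ENNReal.mul_lt_mul (ENNReal.rpow_lt_rpow hx ha) (ENNReal.rpow_lt_rpow hy hb)
        _ ≤ _ := hfgh x y
    have hvol : ∀ (c : ℝ) (S : Set ℝ), 0 < c → volume (c • S) = ENNReal.ofReal c * volume S := by
      intro c S hc
      simp [Measure.addHaar_smul, abs_of_pos hc]
    rw [← hvol a _ ha, ← hvol b _ hb]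
    refine le_trans ?_ (measure_mono hsub)
    exact volume_add_le_volume_add (hS.const_smul₀ a) (hT.const_smul₀ b)
      (Set.Nonempty.smul_set (hfs _ ht₁)) (Set.Nonempty.smul_set (hgs _ ht₁))
  · refine (Measurable.const_mul (Antitone.measurable ?_) _).aemeasurable
    intro s t hst
    exact measure_mono fun x hx => (ENNReal.ofReal_le_ofReal hst).trans_lt hx

theorem prekopa_leindler_real_of_bounded {a b : ℝ} (ha : 0 < a) (hb : 0 < b) (hab : a + b = 1)
    {f g h : ℝ → ℝ≥0∞} (hf : Measurable f) (hg : Measurable g) (hh : Measurable h)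
    (hf₁ : ⨆ x, f x ≠ ∞) (hg₁ : ⨆ x, g x ≠ ∞)
    (hfgh : ∀ x y, f x ^ a * g y ^ b ≤ h (a * x + b * y)) :
    (∫⁻ x, f x) ^ a * (∫⁻ x, g x) ^ b ≤ ∫⁻ x, h x := by
  set F := ⨆ x, f x
  set G := ⨆ x, g x
  rcases eq_or_ne F 0 with hF | hF
  · simp [ENNReal.iSup_eq_zero.1 hF, ha]
  rcases eq_or_ne G 0 with hG | hG
  · simp [ENNReal.iSup_eq_zero.1 hG, hb]
  have key : ∀ (φ : ℝ → ℝ≥0∞), ⨆ x, φ x ≠ 0 → ⨆ x, φ x ≠ ∞ →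
      (∀ x, (⨆ y, φ y)⁻¹ * φ x ≤ 1) ∧ ∀ u < 1, ∃ x, u < (⨆ y, φ y)⁻¹ * φ x := by
    intro φ h₀ h₁
    have hsup : ⨆ x, (⨆ y, φ y)⁻¹ * φ x = 1 := by
      rw [← ENNReal.mul_iSup, ENNReal.inv_mul_cancel h₀ h₁]
    exact ⟨fun x => hsup ▸ le_iSup (fun x => (⨆ y, φ y)⁻¹ * φ x) x,
      fun u hu => lt_iSup_iff.1 (hsup ▸ hu)⟩
  have hc₀ : F ^ a * G ^ b ≠ 0 := by simp [ENNReal.rpow_eq_zero_iff, hF, hG, hf₁, hg₁]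
  have hc₁ : F ^ a * G ^ b ≠ ∞ :=
    ENNReal.mul_ne_top (ENNReal.rpow_ne_top_of_nonneg ha.le hf₁)
      (ENNReal.rpow_ne_top_of_nonneg hb.le hg₁)
  have hmul : ∀ x y : ℝ≥0∞,
      (F⁻¹ * x) ^ a * (G⁻¹ * y) ^ b = (F ^ a * G ^ b)⁻¹ * (x ^ a * y ^ b) := by
    intro x y
    rw [ENNReal.mul_rpow_of_nonneg _ _ ha.le, ENNReal.mul_rpow_of_nonneg _ _ hb.le,
      ENNReal.inv_rpow, ENNReal.inv_rpow,
      ENNReal.mul_inv (by simp [ENNReal.rpow_eq_zero_iff, hF, hf₁])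
        (Or.inl (ENNReal.rpow_ne_top_of_nonneg ha.le hf₁))]
    ring
  have h := prekopa_leindler_real_of_le_one ha hb hab (hf.const_mul F⁻¹) (hg.const_mul G⁻¹)
    (hh.const_mul (F ^ a * G ^ b)⁻¹) (key f hF hf₁).1 (key g hG hg₁).1 (key f hF hf₁).2
    (key g hG hg₁).2 fun x y => by
      rw [hmul]
      gcongr
      exact hfgh x y
  rw [lintegral_const_mul _ hf, lintegral_const_mul _ hg, lintegral_const_mul _ hh, hmul] at h
  exact (ENNReal.mul_le_mul_iff_right (ENNReal.inv_ne_zero.2 hc₁) (ENNReal.inv_ne_top.2 hc₀)).1 h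

/-- The Prékopa-Leindler inequality on `ℝ`. -/
theorem prekopa_leindler_real {a b : ℝ} (ha : 0 < a) (hb : 0 < b) (hab : a + b = 1)
    {f g h : ℝ → ℝ≥0∞} (hf : Measurable f) (hg : Measurable g) (hh : Measurable h)
    (hfgh : ∀ x y, f x ^ a * g y ^ b ≤ h (a * x + b * y)) :
    (∫⁻ x, f x) ^ a * (∫⁻ x, g x) ^ b ≤ ∫⁻ x, h x := by
  rcases eq_or_ne (∫⁻ x, f x) 0 with hF | hF
  · simp [hF, ha]
  rcases eq_or_ne (∫⁻ x, g x) 0 with hG | hG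
  · simp [hG, hb]
  have htrunc : ∀ {φ : ℝ → ℝ≥0∞}, Measurable φ →
      Tendsto (fun k : ℕ => ∫⁻ x, min (φ x) k) atTop (𝓝 (∫⁻ x, φ x)) := by
    intro φ hφ
    refine lintegral_tendsto_of_tendsto_of_monotone
      (fun k => (hφ.min measurable_const).aemeasurable)
      (ae_of_all _ fun x k l hkl => min_le_min_left _ (Nat.cast_le.2 hkl))
      (ae_of_all _ fun x => ?_)
    simpa using tendsto_const_nhds.min ENNReal.tendsto_nat_nhds_top
  have hlim : Tendsto (fun k : ℕ => (∫⁻ x, min (f x) k) ^ a * (∫⁻ x, min (g x) k) ^ b) atTop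
      (𝓝 ((∫⁻ x, f x) ^ a * (∫⁻ x, g x) ^ b)) :=
    ENNReal.Tendsto.mul ((htrunc hf).ennrpow_const a)
      (Or.inl (by simp [ENNReal.rpow_eq_zero_iff, hF, ha.not_gt]))
      ((htrunc hg).ennrpow_const b)
      (Or.inl (by simp [ENNReal.rpow_eq_zero_iff, hG, hb.not_gt]))
  have hbdd : ∀ (φ : ℝ → ℝ≥0∞) (k : ℕ), ⨆ x, min (φ x) k ≠ ∞ := fun φ k =>
    ((iSup_le fun x => min_le_right _ _).trans_lt (ENNReal.natCast_lt_top k)).ne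
  refine le_of_tendsto' hlim fun k => ?_
  refine prekopa_leindler_real_of_bounded ha hb hab (hf.min measurable_const)
    (hg.min measurable_const) hh (hbdd f k) (hbdd g k) fun x y => le_trans ?_ (hfgh x y)
  gcongr <;> exact min_le_left _ _

theorem lintegral_pi_fin_succ {n : ℕ} {f : (Fin (n + 1) → ℝ) → ℝ≥0∞} (hf : Measurable f) :
    ∫⁻ x, f x = ∫⁻ t : ℝ, ∫⁻ y : Fin n → ℝ, f (Fin.cons t y) := by
  rw [← (volume_preserving_piFinSuccAbove (fun _ : Fin (n + 1) => ℝ) 0).symm.lintegral_comp hf,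
    Measure.volume_eq_prod, lintegral_prod]
  · simp [MeasurableEquiv.piFinSuccAbove]
    rfl
  · exact (hf.comp (MeasurableEquiv.measurable _)).aemeasurable

/-- The Prékopa-Leindler inequality on `Fin n → ℝ`. -/
theorem prekopa_leindler_pi {a b : ℝ} (ha : 0 < a) (hb : 0 < b) (hab : a + b = 1) {n : ℕ}
    {f g h : (Fin n → ℝ) → ℝ≥0∞} (hf : Measurable f) (hg : Measurable g) (hh : Measurable h)
    (hfgh : ∀ x y, f x ^ a * g y ^ b ≤ h (a • x + b • y)) :
    (∫⁻ x, f x) ^ a * (∫⁻ x, g x) ^ b ≤ ∫⁻ x, h x := by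
  induction n with
  | zero =>
    simp only [Measure.volume_pi_eq_dirac (default : Fin 0 → ℝ), lintegral_dirac]
    refine (hfgh _ _).trans_eq (congrArg h (Subsingleton.elim _ _))
  | succ n ih =>
    have hc : Measurable fun p : ℝ × (Fin n → ℝ) => (Fin.cons p.1 p.2 : Fin (n + 1) → ℝ) := by
      refine measurable_pi_lambda _ fun i => ?_
      refine Fin.cases ?_ (fun j => ?_) i
      · simpa using measurable_fst
      · simpa using measurable_snd.eval
    rw [lintegral_pi_fin_succ hf, lintegral_pi_fin_succ hg, lintegral_pi_fin_succ hh]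
    refine prekopa_leindler_real ha hb hab (hf.comp hc).lintegral_prod_right'
      (hg.comp hc).lintegral_prod_right' (hh.comp hc).lintegral_prod_right' fun s t => ?_
    have hs : ∀ s, Measurable fun y : Fin n → ℝ => (Fin.cons s y : Fin (n + 1) → ℝ) :=
      fun s => hc.comp measurable_prodMk_left
    refine ih (hf.comp (hs s)) (hg.comp (hs t)) (hh.comp (hs _)) fun x y => ?_
    refine (hfgh _ _).trans_eq (congrArg h ?_)
    funext i
    refine Fin.cases ?_ (fun j => ?_) i <;> simp

theorem prekopa_leindler_euclideanSpace {a b : ℝ} (ha : 0 < a) (hb : 0 < b) (hab : a + b = 1)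
    {n : ℕ} {f g h : EuclideanSpace ℝ (Fin n) → ℝ≥0∞} (hf : Measurable f) (hg : Measurable g)
    (hh : Measurable h) (hfgh : ∀ x y, f x ^ a * g y ^ b ≤ h (a • x + b • y)) :
    (∫⁻ x, f x) ^ a * (∫⁻ x, g x) ^ b ≤ ∫⁻ x, h x := by
  have hv := PiLp.volume_preserving_toLp (Fin n)
  rw [← hv.lintegral_comp hf, ← hv.lintegral_comp hg, ← hv.lintegral_comp hh]
  exact prekopa_leindler_pi ha hb hab (hf.comp hv.measurable) (hg.comp hv.measurable)
    (hh.comp hv.measurable) fun x y => hfgh _ _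

theorem AntilipschitzWith.volume_le_volume_image {n : ℕ}
    {ψ : EuclideanSpace ℝ (Fin n) → EuclideanSpace ℝ (Fin n)} (hψ : AntilipschitzWith 1 ψ)
    (S : Set (EuclideanSpace ℝ (Fin n))) : volume S ≤ volume (ψ '' S) := by
  rw [← EuclideanSpace.euclideanHausdorffMeasure_eq_volume,
    Measure.euclideanHausdorffMeasure_def, Measure.smul_apply, Measure.smul_apply]
  refine smul_le_smul_of_nonneg_left ?_ zero_le
  simpa using hψ.le_hausdorffMeasure_image n.cast_nonneg S

theorem AntilipschitzWith.lintegral_ofReal_le {n : ℕ}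
    {ψ : EuclideanSpace ℝ (Fin n) → EuclideanSpace ℝ (Fin n)} (hψ : AntilipschitzWith 1 ψ)
    {f g : EuclideanSpace ℝ (Fin n) → ℝ} (hf : Measurable f) (hg : Measurable g)
    (hf₀ : 0 ≤ f) (hg₀ : 0 ≤ g) (hfg : ∀ x, f x ≤ g (ψ x)) :
    ∫⁻ x, ENNReal.ofReal (f x) ≤ ∫⁻ x, ENNReal.ofReal (g x) := by
  rw [lintegral_eq_lintegral_meas_lt _ (ae_of_all _ hf₀) hf.aemeasurable,
    lintegral_eq_lintegral_meas_lt _ (ae_of_all _ hg₀) hg.aemeasurable]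
  refine lintegral_mono fun t => (hψ.volume_le_volume_image _).trans (measure_mono ?_)
  rintro _ ⟨x, hx, rfl⟩
  exact lt_of_lt_of_le hx (hfg x)

/-- The integrand in the definition of `shtarkov`. -/
def shtarkovDensity (n : ℕ) (A : Set (EuclideanSpace ℝ (Fin n)))
    (x : EuclideanSpace ℝ (Fin n)) : ℝ :=
  (2 * π) ^ (-(n : ℝ) / 2) * Real.exp (-(Metric.infDist x A) ^ 2 / 2)

section

variable {n : ℕ} {A : Set (EuclideanSpace ℝ (Fin n))}

theorem shtarkovDensity_pos (x : EuclideanSpace ℝ (Fin n)) : 0 < shtarkovDensity n A x := by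
  unfold shtarkovDensity
  positivity

theorem continuous_shtarkovDensity : Continuous (shtarkovDensity n A) := by
  have := Metric.continuous_infDist_pt A
  unfold shtarkovDensity
  fun_prop

theorem shtarkov_ne_zero : shtarkov n A ≠ 0 := by
  have hm : Measurable fun x => ENNReal.ofReal (shtarkovDensity n A x) :=
    continuous_shtarkovDensity.measurable.ennreal_ofReal
  have h : 0 < ∫⁻ x, ENNReal.ofReal (shtarkovDensity n A x) := by
    rw [lintegral_pos_iff_support hm]
    have : Function.support (fun x => ENNReal.ofReal (shtarkovDensity n A x)) = univ := by
      ext x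
      simp [shtarkovDensity_pos x]
    rw [this]
    exact NeZero.pos _
  exact h.ne'

theorem integrable_exp_neg_mul_sq_norm {b : ℝ} (hb : 0 < b) :
    Integrable fun x : EuclideanSpace ℝ (Fin n) => Real.exp (-b * ‖x‖ ^ 2) := by
  by_contra h
  have h₁ := GaussianFourier.integral_rexp_neg_mul_sq_norm (V := EuclideanSpace ℝ (Fin n)) hb
  rw [integral_undef h] at h₁
  have : 0 < (π / b) ^ (Module.finrank ℝ (EuclideanSpace ℝ (Fin n)) / 2 : ℝ) := by positivity
  exact this.ne h₁

theorem shtarkov_ne_top (hA : A.Nonempty) (hbdd : Bornology.IsBounded A) : shtarkov n A ≠ ∞ := by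
  obtain ⟨R, hR⟩ := hbdd.exists_norm_le
  have hle : ∀ x, shtarkovDensity n A x ≤
      (2 * π) ^ (-(n : ℝ) / 2) * Real.exp (R ^ 2 / 2) * Real.exp (-(1 / 4) * ‖x‖ ^ 2) := by
    intro x
    have hd : ‖x‖ - R ≤ Metric.infDist x A := by
      refine (Metric.le_infDist hA).2 fun y hy => ?_
      have h₁ := norm_sub_norm_le x y
      have h₂ := hR y hy
      rw [dist_eq_norm]
      linarith
    have hd₀ : 0 ≤ Metric.infDist x A := Metric.infDist_nonneg
    rw [shtarkovDensity, mul_assoc, ← Real.exp_add]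
    gcongr
    have h₃ : ‖x‖ ^ 2 ≤ (Metric.infDist x A + R) ^ 2 :=
      pow_le_pow_left₀ (norm_nonneg x) (by linarith) 2
    nlinarith [sq_nonneg (Metric.infDist x A - R)]
  refine (lt_of_le_of_lt (lintegral_mono fun x => ENNReal.ofReal_le_ofReal (hle x)) ?_).ne
  exact ((integrable_exp_neg_mul_sq_norm (by norm_num)).const_mul _).lintegral_lt_top

theorem shtarkov_singleton_zero : shtarkov n {0} = 1 := by
  have h := GaussianFourier.integral_rexp_neg_mul_sq_norm (V := EuclideanSpace ℝ (Fin n))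
    (b := 1 / 2) (by norm_num)
  have hint := integrable_exp_neg_mul_sq_norm (n := n) (b := 1 / 2) (by norm_num)
  have heq : ∀ x : EuclideanSpace ℝ (Fin n), shtarkovDensity n {0} x =
      (2 * π) ^ (-(n : ℝ) / 2) * Real.exp (-(1 / 2) * ‖x‖ ^ 2) := by
    intro x
    simp only [shtarkovDensity, Metric.infDist_singleton, dist_zero_right]
    ring_nf
  change ∫⁻ x, ENNReal.ofReal (shtarkovDensity n {0} x) = 1
  simp_rw [heq]
  rw [← ofReal_integral_eq_lintegral_ofReal (hint.const_mul _) (ae_of_all _ fun x => by positivity),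
    integral_const_mul, h, finrank_euclideanSpace_fin, show π / (1 / 2) = 2 * π by ring,
    ← Real.rpow_add (by positivity)]
  simp [neg_div]

theorem exists_mem_closure_infDist_smul (hA : A.Nonempty) (hbdd : Bornology.IsBounded A) {s : ℝ}
    (hs : s ≠ 0) (x : EuclideanSpace ℝ (Fin n)) :
    ∃ θ ∈ closure A, Metric.infDist x (s • A) = dist x (s • θ) := by
  have hc : IsCompact (s • closure A) := hbdd.isCompact_closure.smul s
  obtain ⟨_, ⟨θ, hθ, rfl⟩, h⟩ := hc.exists_infDist_eq_dist hA.closure.smul_set x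
  refine ⟨θ, hθ, ?_⟩
  rw [← h, ← closure_smul₀' hs, Metric.infDist_closure]

theorem infDist_smul_le_dist {θ : EuclideanSpace ℝ (Fin n)} (hθ : θ ∈ closure A) {s : ℝ}
    (hs : s ≠ 0) (x : EuclideanSpace ℝ (Fin n)) :
    Metric.infDist x (s • A) ≤ dist x (s • θ) := by
  rw [← Metric.infDist_closure, closure_smul₀' hs]
  exact Metric.infDist_le_dist_of_mem (smul_mem_smul_set hθ)

/-- Moving each `x` along with its nearest point in `s • A` to `t • A` is an expanding map which does
not increase the distance to the set. -/
theorem shtarkov_smul_mono (hA : A.Nonempty) (hbdd : Bornology.IsBounded A) {s t : ℝ}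
    (hs : 0 < s) (hst : s ≤ t) : shtarkov n (s • A) ≤ shtarkov n (t • A) := by
  choose θ hθ hdist using exists_mem_closure_infDist_smul hA hbdd hs.ne'
  have hψ : AntilipschitzWith 1 fun x => x + (t - s) • θ x := by
    refine AntilipschitzWith.of_le_mul_dist fun x y => ?_
    have hxy : dist x (s • θ x) ≤ dist x (s • θ y) :=
      hdist x ▸ infDist_smul_le_dist (hθ y) hs.ne' x
    have hyx : dist y (s • θ y) ≤ dist y (s • θ x) :=
      hdist y ▸ infDist_smul_le_dist (hθ x) hs.ne' y
    have hmono : 0 ≤ inner ℝ (x - y) (θ x - θ y) := by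
      rw [dist_eq_norm, dist_eq_norm] at hxy hyx
      have h₁ := pow_le_pow_left₀ (norm_nonneg _) hxy 2
      have h₂ := pow_le_pow_left₀ (norm_nonneg _) hyx 2
      simp only [norm_sub_sq_real, inner_smul_right] at h₁ h₂
      simp only [inner_sub_left, inner_sub_right]
      nlinarith
    rw [NNReal.coe_one, one_mul, dist_eq_norm, dist_eq_norm]
    refine le_of_sq_le_sq ?_ (norm_nonneg _)
    have : x + (t - s) • θ x - (y + (t - s) • θ y) = (x - y) + (t - s) • (θ x - θ y) := by
      module
    rw [this, norm_add_sq_real, inner_smul_right]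
    nlinarith [mul_nonneg (sub_nonneg.2 hst) hmono, sq_nonneg ‖(t - s) • (θ x - θ y)‖]
  refine hψ.lintegral_ofReal_le (f := shtarkovDensity n (s • A)) (g := shtarkovDensity n (t • A))
    continuous_shtarkovDensity.measurable continuous_shtarkovDensity.measurable
    (fun x => (shtarkovDensity_pos x).le) (fun x => (shtarkovDensity_pos x).le) fun x => ?_
  have h₁ : Metric.infDist (x + (t - s) • θ x) (t • A) ≤ Metric.infDist x (s • A) := by
    refine (infDist_smul_le_dist (hθ x) (hs.trans_le hst).ne' _).trans_eq ?_
    rw [hdist x, dist_eq_norm, dist_eq_norm]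
    congr 1
    module
  have h₂ : 0 ≤ Metric.infDist (x + (t - s) • θ x) (t • A) := Metric.infDist_nonneg
  unfold shtarkovDensity
  gcongr

theorem sq_norm_convex_comb_le {E : Type*} [NormedAddCommGroup E] [InnerProductSpace ℝ E]
    {a b : ℝ} (ha : 0 ≤ a) (hb : 0 ≤ b) (hab : a + b = 1) (x y : E) :
    ‖a • x + b • y‖ ^ 2 ≤ a * ‖x‖ ^ 2 + b * ‖y‖ ^ 2 := by
  have h₁ : ‖a • x + b • y‖ ≤ a * ‖x‖ + b * ‖y‖ := by
    refine (norm_add_le _ _).trans_eq ?_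
    rw [norm_smul, norm_smul, Real.norm_of_nonneg ha, Real.norm_of_nonneg hb]
  have h₂ := pow_le_pow_left₀ (norm_nonneg _) h₁ 2
  obtain rfl : a = 1 - b := by linarith
  nlinarith [mul_nonneg (mul_nonneg ha hb) (sq_nonneg (‖x‖ - ‖y‖))]

/-- The Prékopa-Leindler inequality applied to the standard Gaussian density and the density
of `t • A`. -/
theorem shtarkov_smul_rpow_le (hA : A.Nonempty) (hbdd : Bornology.IsBounded A) {s t : ℝ}
    (hs : 0 < s) (hst : s < t) : shtarkov n (t • A) ^ (s / t) ≤ shtarkov n (s • A) := by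
  have ht : 0 < t := hs.trans hst
  set b := s / t 
  have hb : 0 < b := div_pos hs ht
  have ha : 0 < 1 - b := sub_pos.2 ((div_lt_one ht).2 hst)
  have hbt : b * t = s := div_mul_cancel₀ s ht.ne'
  have hm : ∀ B : Set (EuclideanSpace ℝ (Fin n)),
      Measurable fun x => ENNReal.ofReal (shtarkovDensity n B x) := fun B =>
    continuous_shtarkovDensity.measurable.ennreal_ofReal
  have h := prekopa_leindler_euclideanSpace ha hb (by ring) (hm {0}) (hm (t • A)) (hm (s • A))
    fun x y => by
      obtain ⟨θ, hθ, hdist⟩ := exists_mem_closure_infDist_smul hA hbdd ht.ne' y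
      have h₁ : Metric.infDist ((1 - b) • x + b • y) (s • A) ^ 2 ≤
          (1 - b) * ‖x‖ ^ 2 + b * Metric.infDist y (t • A) ^ 2 := by
        rw [hdist, dist_eq_norm]
        refine le_trans ?_ (sq_norm_convex_comb_le ha.le hb.le (by ring) x (y - t • θ))
        refine pow_le_pow_left₀ Metric.infDist_nonneg ?_ 2
        refine (infDist_smul_le_dist hθ hs.ne' _).trans_eq ?_
        rw [dist_eq_norm, ← hbt]
        congr 1
        module
      rw [ENNReal.ofReal_rpow_of_pos (shtarkovDensity_pos x),
        ENNReal.ofReal_rpow_of_pos (shtarkovDensity_pos y),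
        ← ENNReal.ofReal_mul (Real.rpow_nonneg (shtarkovDensity_pos x).le _)]
      refine ENNReal.ofReal_le_ofReal ?_
      simp only [shtarkovDensity, Metric.infDist_singleton, dist_zero_right]
      have hc : 0 < (2 * π) ^ (-(n : ℝ) / 2) := by positivity
      generalize (2 * π) ^ (-(n : ℝ) / 2) = c at hc
      rw [Real.mul_rpow (by positivity) (by positivity),
        Real.mul_rpow (by positivity) (by positivity), mul_mul_mul_comm,
        ← Real.rpow_add (by positivity), sub_add_cancel, Real.rpow_one, ← Real.exp_mul,
        ← Real.exp_mul, ← Real.exp_add]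
      gcongr
      linarith
  change shtarkov n {0} ^ (1 - b) * shtarkov n (t • A) ^ b ≤ shtarkov n (s • A) at h
  rwa [shtarkov_singleton_zero, ENNReal.one_rpow, one_mul] at h

end

/-- Monotonicity in the scale / noise level: for a nonempty bounded set `A ⊆ ℝⁿ`,
`t ↦ R*(tA)` is non-decreasing and `t ↦ R*(tA)/t` is non-increasing on `(0, ∞)`. -/
theorem regret_scale_monotone (n : ℕ) (A : Set (EuclideanSpace ℝ (Fin n)))
    (hA : A.Nonempty) (hbdd : Bornology.IsBounded A) :
    (∀ s t : ℝ, 0 < s → s ≤ t → regretReal n (s • A) ≤ regretReal n (t • A)) ∧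
    (∀ s t : ℝ, 0 < s → s ≤ t → regretReal n (t • A) / t ≤ regretReal n (s • A) / s) := by
  have htop : ∀ r : ℝ, shtarkov n (r • A) ≠ ∞ := fun r =>
    shtarkov_ne_top hA.smul_set (hbdd.smul₀ r)
  have hpos : ∀ r : ℝ, 0 < (shtarkov n (r • A)).toReal := fun r =>
    ENNReal.toReal_pos shtarkov_ne_zero (htop r)
  refine ⟨fun s t hs hst => ?_, fun s t hs hst => ?_⟩
  · exact Real.log_le_log (hpos s)
      (ENNReal.toReal_mono (htop t) (shtarkov_smul_mono hA hbdd hs hst))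
  · rcases hst.eq_or_lt with rfl | hst
    · exact le_rfl
    have h := Real.log_le_log (by rw [← ENNReal.toReal_rpow]; exact Real.rpow_pos_of_pos (hpos t) _)
      (ENNReal.toReal_mono (htop s) (shtarkov_smul_rpow_le hA hbdd hs hst))
    rw [← ENNReal.toReal_rpow, Real.log_rpow (hpos t)] at h
    rw [le_div_iff₀ hs]
    refine le_trans (le_of_eq ?_) h
    rw [regretReal]
    ring
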